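/- arXiv:2512.18141 — 5 statements merged into one kernel-verified Lean document; each statement's English description precedes it below -/
import Mathlib

section
/- If S and S' are both minimum (s,t)-cuts, then S ∪ S' and S ∩ S' are also minimum (s,t)-cuts; consequently, the set of minimum (s,t)-cuts, ordered by inclusion, forms a distributive lattice (a sublattice of the powerset of V). -/
open scoped Classical

/-- An `(s,t)`-cut: a set of vertices containing `s` but not `t`. -/
def IsCut {V : Type*} (s t : V) (S : Set V) : Prop := s ∈ S ∧ t ∉ S

/-- The capacity of a cut `S`: the total capacity of edges from `S` to its complement. -/
noncomputable def cutCap {V : Type*} [Fintype V] (c : V → V → NNReal) (S : Set V) : NNReal :=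
  ∑ u : V, ∑ v : V, if u ∈ S ∧ v ∉ S then c u v else 0

/-- A minimum `(s,t)`-cut. -/
def IsMinCut {V : Type*} [Fintype V] (s t : V) (c : V → V → NNReal) (S : Set V) : Prop :=
  IsCut s t S ∧ ∀ S', IsCut s t S' → cutCap c S ≤ cutCap c S'

/-- The cut capacity is submodular. -/
theorem cutCap_union_add_cutCap_inter_le {V : Type*} [Fintype V] (c : V → V → NNReal)
    (S S' : Set V) :
    cutCap c (S ∪ S') + cutCap c (S ∩ S') ≤ cutCap c S + cutCap c S' := by
  simp only [cutCap, ← Finset.sum_add_distrib]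
  refine Finset.sum_le_sum fun u _ => Finset.sum_le_sum fun v _ => ?_
  by_cases hu : u ∈ S <;> by_cases hu' : u ∈ S' <;> by_cases hv : v ∈ S <;>
    by_cases hv' : v ∈ S' <;> simp [hu, hu', hv, hv']

/-- The union and intersection of two min-cuts are min-cuts, so the min-cuts form a
distributive lattice (a sublattice of the powerset of `V`). -/
theorem minCut_union_inter {V : Type*} [Fintype V] (s t : V) (hst : s ≠ t)
    (c : V → V → NNReal) (S S' : Set V)
    (hS : IsMinCut s t c S) (hS' : IsMinCut s t c S') :
    IsMinCut s t c (S ∪ S') ∧ IsMinCut s t c (S ∩ S') := by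
  obtain ⟨⟨hs, ht⟩, hmin⟩ := hS
  obtain ⟨⟨hs', ht'⟩, hmin'⟩ := hS'
  have hunion : IsCut s t (S ∪ S') := ⟨Or.inl hs, fun h => h.elim ht ht'⟩
  have hinter : IsCut s t (S ∩ S') := ⟨⟨hs, hs'⟩, fun h => ht h.1⟩
  have hsub := cutCap_union_add_cutCap_inter_le c S S'
  have hle : cutCap c (S ∪ S') ≤ cutCap c S :=
    le_of_add_le_add_right (hsub.trans (add_le_add_right (hmin' _ hinter) _))
  have hle' : cutCap c (S ∩ S') ≤ cutCap c S' :=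
    le_of_add_le_add_left (hsub.trans (add_le_add_left (hmin _ hunion) _))
  exact ⟨⟨hunion, fun T hT => hle.trans (hmin T hT)⟩,
    ⟨hinter, fun T hT => hle'.trans (hmin' T hT)⟩⟩
end

section
/- Let f* be a max-flow and let S be an (s,t)-cut. Then S is a min-cut if and only if f* u v = c u v for all u ∈ S and v ∉ S (every forward edge across the cut is saturated), and f* u v = 0 for all u ∉ S and v ∈ S (every backward edge across the cut carries zero flow). -/
open scoped Classical

/-- A flow: capacity-respecting and conserving at every non-terminal vertex. -/
def IsFlow {V : Type*} [Fintype V] (s t : V) (c : V → V → NNReal) (f : V → V → NNReal) : Prop :=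
  (∀ u v, f u v ≤ c u v) ∧
    ∀ w, w ≠ s → w ≠ t → (∑ u : V, f u w) = (∑ u : V, f w u)

/-- The value of a flow: net outflow of the source. -/
noncomputable def flowValue {V : Type*} [Fintype V] (s : V) (f : V → V → NNReal) : ℝ :=
  (∑ v : V, (f s v : ℝ)) - ∑ v : V, (f v s : ℝ)

/-- A maximum flow. -/
def IsMaxFlow {V : Type*} [Fintype V] (s t : V) (c : V → V → NNReal)
    (f : V → V → NNReal) : Prop :=
  IsFlow s t c f ∧ ∀ g, IsFlow s t c g → flowValue s g ≤ flowValue s f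

/-- The net outflow of `w` under a real-valued edge function `d`. -/
noncomputable def netOut {V : Type*} [Fintype V] (d : V → V → ℝ) (w : V) : ℝ :=
  ∑ v, d w v - ∑ v, d v w

theorem netOut_add {V : Type*} [Fintype V] (d e : V → V → ℝ) (w : V) :
    netOut (fun u v => d u v + e u v) w = netOut d w + netOut e w := by
  simp only [netOut, Finset.sum_add_distrib]
  ring

theorem netOut_const_mul {V : Type*} [Fintype V] (a : ℝ) (d : V → V → ℝ) (w : V) :
    netOut (fun u v => a * d u v) w = a * netOut d w := by
  simp only [netOut, ← Finset.mul_sum]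
  ring

theorem netOut_single {V : Type*} [Fintype V] (a b w : V) :
    netOut (fun u v => if u = a ∧ v = b then 1 else 0) w =
      (if w = a then 1 else 0) - (if w = b then 1 else 0) := by
  simp [netOut, ite_and]

theorem sum_netOut_eq_sum_boundary {V : Type*} [Fintype V] (d : V → V → ℝ) (S : Set V) :
    (∑ w, if w ∈ S then netOut d w else 0) =
      ∑ u, ∑ v, ((if u ∈ S ∧ v ∉ S then d u v else 0) - if u ∉ S ∧ v ∈ S then d u v else 0) := by
  have h : (∑ w, if w ∈ S then netOut d w else 0) =
      ∑ u, ∑ v, ((if u ∈ S then d u v else 0) - if v ∈ S then d u v else 0) := by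
    simp only [Finset.sum_sub_distrib]
    rw [Finset.sum_comm (f := fun u v => if v ∈ S then d u v else 0),
      ← Finset.sum_sub_distrib]
    refine Finset.sum_congr rfl fun w _ => ?_
    by_cases hw : w ∈ S <;> simp [hw, netOut]
  rw [h]
  refine Finset.sum_congr rfl fun u _ => Finset.sum_congr rfl fun v _ => ?_
  by_cases hu : u ∈ S <;> by_cases hv : v ∈ S <;> simp [hu, hv]

theorem IsFlow.netOut_eq_zero {V : Type*} [Fintype V] {s t : V} {c f : V → V → NNReal}
    (hf : IsFlow s t c f) {w : V} (hs : w ≠ s) (ht : w ≠ t) :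
    netOut (fun u v => (f u v : ℝ)) w = 0 := by
  have h := congrArg NNReal.toReal (hf.2 w hs ht)
  push_cast at h
  simp [netOut, h]

/-- The unused forward capacity across `S` plus the backward flow across `S`. -/
noncomputable def cutSlack {V : Type*} [Fintype V] (c f : V → V → NNReal) (S : Set V) : ℝ :=
  ∑ u, ∑ v, ((if u ∈ S ∧ v ∉ S then (c u v - f u v : ℝ) else 0) +
    if u ∉ S ∧ v ∈ S then (f u v : ℝ) else 0)

theorem IsFlow.cutCap_eq {V : Type*} [Fintype V] {s t : V} {c f : V → V → NNReal}
    (hf : IsFlow s t c f) {S : Set V} (hS : IsCut s t S) :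
    (cutCap c S : ℝ) = flowValue s f + cutSlack c f S := by
  have hval : flowValue s f =
      ∑ w, if w ∈ S then netOut (fun u v => (f u v : ℝ)) w else 0 := by
    rw [Finset.sum_eq_single s]
    · simp [hS.1, netOut, flowValue]
    · intro w _ hws
      by_cases hw : w ∈ S
      · rw [if_pos hw]
        exact hf.netOut_eq_zero hws fun h => hS.2 (h ▸ hw)
      · exact if_neg hw
    · simp
  rw [hval, sum_netOut_eq_sum_boundary, cutSlack, cutCap, ← Finset.sum_add_distrib]
  push_cast
  refine Finset.sum_congr rfl fun u _ => ?_
  rw [← Finset.sum_add_distrib]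
  refine Finset.sum_congr rfl fun v _ => ?_
  by_cases hu : u ∈ S <;> by_cases hv : v ∈ S <;> simp [hu, hv]

theorem cutSlack_term_nonneg {V : Type*} {c f : V → V → NNReal}
    (hf : ∀ u v, f u v ≤ c u v) (S : Set V) (u v : V) :
    0 ≤ (if u ∈ S ∧ v ∉ S then (c u v - f u v : ℝ) else 0) +
      if u ∉ S ∧ v ∈ S then (f u v : ℝ) else 0 := by
  have h : (f u v : ℝ) ≤ c u v := hf u v
  refine add_nonneg ?_ ?_ <;> split_ifs <;> linarith [(f u v).coe_nonneg]

theorem cutSlack_nonneg {V : Type*} [Fintype V] {c f : V → V → NNReal}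
    (hf : ∀ u v, f u v ≤ c u v) (S : Set V) : 0 ≤ cutSlack c f S :=
  Finset.sum_nonneg fun u _ => Finset.sum_nonneg fun v _ => cutSlack_term_nonneg hf S u v

theorem cutSlack_eq_zero_iff {V : Type*} [Fintype V] {c f : V → V → NNReal}
    (hf : ∀ u v, f u v ≤ c u v) (S : Set V) :
    cutSlack c f S = 0 ↔
      (∀ u v, u ∈ S → v ∉ S → f u v = c u v) ∧ (∀ u v, u ∉ S → v ∈ S → f u v = 0) := by
  rw [cutSlack, Finset.sum_eq_zero_iff_of_nonneg
    fun u _ => Finset.sum_nonneg fun v _ => cutSlack_term_nonneg hf S u v]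
  simp only [Finset.sum_eq_zero_iff_of_nonneg fun v _ => cutSlack_term_nonneg hf S _ v,
    Finset.mem_univ, true_implies]
  constructor
  · refine fun h => ⟨fun u v hu hv => ?_, fun u v hu hv => ?_⟩
    · have := h u v
      simp only [hu, hv, not_false_eq_true, not_true_eq_false, and_self, if_true, if_false,
        add_zero] at this
      exact NNReal.eq (by linarith)
    · simpa [hu, hv] using h u v
  · rintro ⟨h₁, h₂⟩ u v
    by_cases hu : u ∈ S <;> by_cases hv : v ∈ S <;> simp [hu, hv, h₁, h₂]

/-- `d` is a direction in which `f` can be perturbed within the capacities `c`. -/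
def IsFeasibleDirection {V : Type*} (c f : V → V → NNReal) (d : V → V → ℝ) : Prop :=
  ∀ u v, (f u v = c u v → d u v ≤ 0) ∧ (f u v = 0 → 0 ≤ d u v)

theorem IsFeasibleDirection.exists_step {V : Type*} [Fintype V] {c f : V → V → NNReal}
    {d : V → V → ℝ} (hf : ∀ u v, f u v ≤ c u v) (hd : IsFeasibleDirection c f d) :
    ∃ ε : ℝ, 0 < ε ∧ ∀ u v, 0 ≤ f u v + ε * d u v ∧ f u v + ε * d u v ≤ c u v := by
  have key : ∀ᶠ ε : ℝ in nhdsWithin 0 (Set.Ioi 0),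
      ∀ u v, 0 ≤ f u v + ε * d u v ∧ f u v + ε * d u v ≤ c u v := by
    refine Filter.eventually_all.2 fun u => Filter.eventually_all.2 fun v => ?_
    have hlim : Filter.Tendsto (fun ε : ℝ => f u v + ε * d u v) (nhdsWithin 0 (Set.Ioi 0))
        (nhds (f u v : ℝ)) := by
      have : Continuous fun ε : ℝ => f u v + ε * d u v := by fun_prop
      simpa using (this.tendsto 0).mono_left nhdsWithin_le_nhds
    refine Filter.Eventually.and ?_ ?_
    · rcases (zero_le (a := f u v)).eq_or_lt with h | h
      · filter_upwards [self_mem_nhdsWithin] with ε hε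
        have := mul_nonneg (le_of_lt hε) ((hd u v).2 h.symm)
        positivity
      · exact (hlim.eventually_const_lt (NNReal.coe_pos.2 h)).mono fun _ => le_of_lt
    · rcases (hf u v).eq_or_lt with h | h
      · filter_upwards [self_mem_nhdsWithin] with ε hε
        have := mul_nonpos_of_nonneg_of_nonpos (le_of_lt hε) ((hd u v).1 h)
        rw [h]
        linarith
      · exact (hlim.eventually_lt_const (NNReal.coe_lt_coe.2 h)).mono fun _ => le_of_lt
  obtain ⟨ε, h, hε⟩ := (key.and self_mem_nhdsWithin).exists
  exact ⟨ε, hε, h⟩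

/-- The vertices to which a unit can be pushed from `s` along a feasible direction. -/
def residualSet {V : Type*} [Fintype V] (s : V) (c f : V → V → NNReal) : Set V :=
  {x | ∃ d : V → V → ℝ, IsFeasibleDirection c f d ∧
    ∀ w, netOut d w = (if w = s then 1 else 0) - if w = x then 1 else 0}

theorem mem_residualSet_self {V : Type*} [Fintype V] (s : V) (c f : V → V → NNReal) :
    s ∈ residualSet s c f :=
  ⟨fun _ _ => 0, fun _ _ => ⟨fun _ => le_rfl, fun _ => le_rfl⟩, fun w => by simp [netOut]⟩

theorem mem_residualSet_of_lt {V : Type*} [Fintype V] {s : V} {c f : V → V → NNReal} {x y : V}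
    (hx : x ∈ residualSet s c f) (h : f x y < c x y) : y ∈ residualSet s c f := by
  obtain ⟨d, hd, hnet⟩ := hx
  refine ⟨fun u v => d u v + if u = x ∧ v = y then 1 else 0, fun u v => ⟨fun huv => ?_,
    fun huv => ?_⟩, fun w => ?_⟩
  · have hne : ¬(u = x ∧ v = y) := by
      rintro ⟨rfl, rfl⟩
      exact h.ne huv
    simpa [hne] using (hd u v).1 huv
  · exact add_nonneg ((hd u v).2 huv) (by split_ifs <;> norm_num)
  · rw [netOut_add, netOut_single, hnet]
    ring

theorem mem_residualSet_of_pos {V : Type*} [Fintype V] {s : V} {c f : V → V → NNReal} {x y : V}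
    (hx : x ∈ residualSet s c f) (h : 0 < f y x) : y ∈ residualSet s c f := by
  obtain ⟨d, hd, hnet⟩ := hx
  refine ⟨fun u v => d u v + -1 * if u = y ∧ v = x then 1 else 0, fun u v => ⟨fun huv => ?_,
    fun huv => ?_⟩, fun w => ?_⟩
  · exact add_nonpos ((hd u v).1 huv) (by split_ifs <;> norm_num)
  · have hne : ¬(u = y ∧ v = x) := by
      rintro ⟨rfl, rfl⟩
      exact h.ne huv.symm
    simpa [hne] using (hd u v).2 huv
  · rw [netOut_add, netOut_const_mul, netOut_single, hnet]
    ring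

theorem IsMaxFlow.sink_notMem_residualSet {V : Type*} [Fintype V] {s t : V} (hst : s ≠ t)
    {c f : V → V → NNReal} (hf : IsMaxFlow s t c f) : t ∉ residualSet s c f := by
  rintro ⟨d, hd, hnet⟩
  obtain ⟨ε, hε, hstep⟩ := hd.exists_step hf.1.1
  let g : V → V → NNReal := fun u v => ⟨f u v + ε * d u v, (hstep u v).1⟩
  have hg : ∀ w, netOut (fun u v => (g u v : ℝ)) w =
      netOut (fun u v => (f u v : ℝ)) w + ε * netOut d w := fun w => by
    rw [← netOut_const_mul, ← netOut_add]
    rfl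
  have hflow : IsFlow s t c g := by
    refine ⟨fun u v => (hstep u v).2, fun w hs ht => NNReal.eq ?_⟩
    have h := hg w
    rw [hf.1.netOut_eq_zero hs ht, hnet, if_neg hs, if_neg ht] at h
    simp only [netOut] at h
    push_cast
    linarith
  have hle : netOut (fun u v => (g u v : ℝ)) s ≤ netOut (fun u v => (f u v : ℝ)) s :=
    hf.2 g hflow
  rw [hg, hnet, if_pos rfl, if_neg hst] at hle
  linarith

theorem IsMaxFlow.exists_cut_cutCap_eq {V : Type*} [Fintype V] {s t : V} (hst : s ≠ t)
    {c f : V → V → NNReal} (hf : IsMaxFlow s t c f) :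
    ∃ R, IsCut s t R ∧ (cutCap c R : ℝ) = flowValue s f := by
  have hR : IsCut s t (residualSet s c f) :=
    ⟨mem_residualSet_self s c f, hf.sink_notMem_residualSet hst⟩
  refine ⟨_, hR, ?_⟩
  rw [hf.1.cutCap_eq hR, (cutSlack_eq_zero_iff hf.1.1 _).2 ⟨fun u v hu hv => ?_,
    fun u v hu hv => ?_⟩, add_zero]
  · exact (hf.1.1 u v).eq_of_not_lt fun h => hv (mem_residualSet_of_lt hu h)
  · exact of_not_not fun h => hu (mem_residualSet_of_pos hv (pos_iff_ne_zero.2 h))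

/-- A cut is a min-cut iff every forward edge across it is saturated by a given max-flow
and every backward edge across it carries zero flow. -/
theorem isMinCut_iff_saturated {V : Type*} [Fintype V] (s t : V) (hst : s ≠ t)
    (c : V → V → NNReal) (f : V → V → NNReal) (hf : IsMaxFlow s t c f)
    (S : Set V) (hS : IsCut s t S) :
    IsMinCut s t c S ↔
      (∀ u v, u ∈ S → v ∉ S → f u v = c u v) ∧
      (∀ u v, u ∉ S → v ∈ S → f u v = 0) := by
  rw [← cutSlack_eq_zero_iff hf.1.1 S]
  have hcap := hf.1.cutCap_eq hS
  constructor
  · intro hmin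
    obtain ⟨R, hR, hRcap⟩ := hf.exists_cut_cutCap_eq hst
    have hle : (cutCap c S : ℝ) ≤ cutCap c R := hmin.2 R hR
    have hnonneg := cutSlack_nonneg hf.1.1 S
    linarith
  · intro hslack
    refine ⟨hS, fun S' hS' => NNReal.coe_le_coe.1 ?_⟩
    have hcap' := hf.1.cutCap_eq hS'
    have hnonneg := cutSlack_nonneg hf.1.1 S'
    linarith
end

section
/- Let V be a nonempty finite type and let B be a predicate on subsets of V. Then B is lattice-linear if and only if for all S, T ⊆ V, B S and B T imply B (S ∩ T) (i.e., the satisfying family of B is closed under pairwise intersection). -/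
/-- `v` is forbidden for `B` in `S`: every superset of `S` agreeing with `S` on `v`
fails `B`. -/
def Forbidden {V : Type*} (B : Set V → Prop) (S : Set V) (v : V) : Prop :=
  ∀ T : Set V, S ⊆ T → (v ∈ T ↔ v ∈ S) → ¬ B T

/-- `B` is lattice-linear: every non-satisfying set contains a forbidden vertex. -/
def LatticeLinear {V : Type*} (B : Set V → Prop) : Prop :=
  ∀ S : Set V, ¬ B S → ∃ v, Forbidden B S v

/-- On a nonempty finite type, a predicate is lattice-linear iff its satisfying family
is closed under pairwise intersection. -/
theorem latticeLinear_iff_inter_closed {V : Type*} [Fintype V] [Nonempty V]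
    (B : Set V → Prop) :
    LatticeLinear B ↔ ∀ S T : Set V, B S → B T → B (S ∩ T) := by
  constructor
  · intro h S T hS hT
    by_contra hST
    obtain ⟨v, hv⟩ := h _ hST
    by_cases hvS : v ∈ S
    · exact hv T Set.inter_subset_right ⟨fun hvT => ⟨hvS, hvT⟩, And.right⟩ hT
    · exact hv S Set.inter_subset_left ⟨fun hvS' => absurd hvS' hvS, And.left⟩ hS
  · intro h S hS
    by_contra hforb
    have hex : ∀ v, ∃ T : Set V, S ⊆ T ∧ (v ∈ T ↔ v ∈ S) ∧ B T := by
      simpa [Forbidden] using hforb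
    choose f hsub hagree hB using hex
    have hinf : Finset.univ.inf' Finset.univ_nonempty f = S := by
      apply le_antisymm
      · intro v hv
        exact (hagree v).1 (Finset.inf'_le f (Finset.mem_univ v) hv)
      · exact Finset.le_inf' _ _ fun v _ => hsub v
    exact hS (hinf ▸ Finset.inf'_induction Finset.univ_nonempty f
      (fun S hS T hT => h S T hS hT) fun v _ => hB v)
end

section
/- Let n ≥ 2 be even, let V = {s, v₁, …, vₙ, t}, and let E = {(s,v₁)} ∪ {(vᵢ, vᵢ₊₁) | 1 ≤ i < n} ∪ {(vₙ, t)}. Define X₁ = {s, v₂}, X₂ = {s, v₁, v₂}, Xᵢ = {s, v₁, …, vᵢ} for even i > 2, and Xᵢ = {s, v₁, …, v_{i−1}, v_{i+1}} for odd i > 2. Then X₁ ⊆ X₂ ⊆ … ⊆ Xₙ is a monotone chain of (s,t)-cuts, and Xᵢ is uniformly directed if and only if i is even. Consequently, the uniformly-directed-cut predicate on this network is not a k-transition predicate for any k < n − 1. -/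
/-- A uniformly directed `(s,t)`-cut: no edge of `E` goes from outside `S` into `S`. -/
def UDCut {V : Type*} (s t : V) (E : Set (V × V)) (S : Set V) : Prop :=
  IsCut s t S ∧ ¬ ∃ u v : V, (u, v) ∈ E ∧ u ∉ S ∧ v ∈ S

open scoped Classical in
/-- `B` is a `k`-transition predicate: along any monotone sequence
`x₀ ≤ x₁ ≤ … ≤ xₙ`, the truth value of `B` changes at most `k` times. -/
def KTransition {L : Type*} [Preorder L] (B : L → Prop) (k : ℕ) : Prop :=
  ∀ (n : ℕ) (x : ℕ → L), Monotone x →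
    ((Finset.range n).filter (fun i => ¬ (B (x i) ↔ B (x (i + 1))))).card ≤ k

/-- The edge set of the path `s = 0 → 1 → ⋯ → n+1 = t` on `Fin (n+2)`,
i.e. `s → v₁`, `vᵢ → vᵢ₊₁` for `1 ≤ i < n`, and `vₙ → t`. -/
def pathE (n : ℕ) : Set (Fin (n + 2) × Fin (n + 2)) :=
  {p | (p.1 : ℕ) + 1 = (p.2 : ℕ)}

/-- The chain of cuts: `X₁ = {s, v₂}`, `X₂ = {s, v₁, v₂}`,
`Xᵢ = {s, v₁, …, vᵢ}` for even `i > 2`, and `Xᵢ = {s, v₁, …, v_{i-1}, v_{i+1}}` for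
odd `i > 2`, where `s = 0` and `vⱼ = j`. -/
def Xchain (n i : ℕ) : Set (Fin (n + 2)) :=
  {j | if Even i then (j : ℕ) ≤ i else ((j : ℕ) < i ∨ (j : ℕ) = i + 1)}

theorem Xchain_monotone (n : ℕ) : Monotone (Xchain n) := by
  refine monotone_nat_of_le_succ fun i j hj => ?_
  simp only [Xchain, Set.mem_ofPred_eq, Nat.even_add_one] at hj ⊢
  split_ifs at hj ⊢ <;> omega

theorem isCut_Xchain {n i : ℕ} (hne : Even n) (hi : 1 ≤ i) (hin : i ≤ n) :
    IsCut (0 : Fin (n + 2)) (Fin.last (n + 1)) (Xchain n i) := by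
  rw [Nat.even_iff] at hne
  simp only [IsCut, Xchain, Set.mem_ofPred_eq, Fin.val_zero, Fin.val_last, Nat.even_iff]
  split_ifs <;> omega

theorem udCut_Xchain_iff {n i : ℕ} (hne : Even n) (hi : 1 ≤ i) (hin : i ≤ n) :
    UDCut (0 : Fin (n + 2)) (Fin.last (n + 1)) (pathE n) (Xchain n i) ↔ Even i := by
  constructor
  · rintro ⟨-, h⟩
    by_contra hodd
    refine h ⟨⟨i, by omega⟩, ⟨i + 1, by omega⟩, rfl, ?_, ?_⟩ <;> simp [Xchain, hodd]
  · refine fun he => ⟨isCut_Xchain hne hi hin, ?_⟩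
    rintro ⟨u, v, huv, hu, hv⟩
    simp only [pathE, Xchain, he, if_true, Set.mem_ofPred_eq] at huv hu hv
    omega

/-- For even `n ≥ 2`, on the path network `s → v₁ → ⋯ → vₙ → t`, the sets
`X₁ ⊆ X₂ ⊆ ⋯ ⊆ Xₙ` form a monotone chain of `(s,t)`-cuts, `Xᵢ` is uniformly directed
iff `i` is even, and consequently the uniformly-directed-cut predicate is not a
`k`-transition predicate for any `k < n - 1`. -/
theorem udCut_not_kTransition (n : ℕ) (hn : 2 ≤ n) (hne : Even n) :
    (∀ i : ℕ, 1 ≤ i → i < n → Xchain n i ⊆ Xchain n (i + 1)) ∧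
    (∀ i : ℕ, 1 ≤ i → i ≤ n →
      IsCut (0 : Fin (n + 2)) (Fin.last (n + 1)) (Xchain n i)) ∧
    (∀ i : ℕ, 1 ≤ i → i ≤ n →
      (UDCut (0 : Fin (n + 2)) (Fin.last (n + 1)) (pathE n) (Xchain n i) ↔ Even i)) ∧
    (∀ k : ℕ, k < n - 1 →
      ¬ KTransition (UDCut (0 : Fin (n + 2)) (Fin.last (n + 1)) (pathE n)) k) := by
  refine ⟨fun i _ _ => Xchain_monotone n i.le_succ, fun i => isCut_Xchain hne,
    fun i => udCut_Xchain_iff hne, fun k hk h => ?_⟩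
  have hcard := h (n - 1) (fun i => Xchain n (i + 1))
    fun i j hij => Xchain_monotone n (Nat.succ_le_succ hij)
  classical
  rw [Finset.filter_true_of_mem, Finset.card_range] at hcard
  · omega
  · intro i hi
    rw [Finset.mem_range] at hi
    rw [udCut_Xchain_iff hne (by omega) (by omega), udCut_Xchain_iff hne (by omega) (by omega),
      Nat.even_add_one (n := i + 1)]
    tauto
end

section
/- Let B be a predicate on (s,t)-cuts whose satisfying family is closed under pairwise intersection, and let v ∈ V. If there exists a min-cut S with B S and v ∈ S, then there exists a least such cut: a min-cut S₀ with B S₀ and v ∈ S₀ such that S₀ ⊆ S' for every min-cut S' with B S' and v ∈ S'. -/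
open scoped Classical

theorem isCut_inter {V : Type*} {s t : V} {S T : Set V} (hS : IsCut s t S) (hT : IsCut s t T) :
    IsCut s t (S ∩ T) :=
  ⟨⟨hS.1, hT.1⟩, fun h => hS.2 h.1⟩

theorem isCut_union {V : Type*} {s t : V} {S T : Set V} (hS : IsCut s t S) (hT : IsCut s t T) :
    IsCut s t (S ∪ T) :=
  ⟨Or.inl hS.1, fun h => h.elim hS.2 hT.2⟩

/-- The cut capacity is submodular. -/
theorem cutCap_inter_add_cutCap_union_le {V : Type*} [Fintype V] (c : V → V → NNReal)
    (S T : Set V) : cutCap c (S ∩ T) + cutCap c (S ∪ T) ≤ cutCap c S + cutCap c T := by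
  simp only [cutCap, ← Finset.sum_add_distrib]
  refine Finset.sum_le_sum fun u _ => Finset.sum_le_sum fun v _ => ?_
  by_cases h₁ : u ∈ S <;> by_cases h₂ : u ∈ T <;> by_cases h₃ : v ∈ S <;>
    by_cases h₄ : v ∈ T <;> simp [h₁, h₂, h₃, h₄]

theorem isMinCut_inter {V : Type*} [Fintype V] {s t : V} {c : V → V → NNReal} {S T : Set V}
    (hS : IsMinCut s t c S) (hT : IsMinCut s t c T) : IsMinCut s t c (S ∩ T) := by
  refine ⟨isCut_inter hS.1 hT.1, fun S' hS' => le_trans ?_ (hS.2 S' hS')⟩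
  have hsub := cutCap_inter_add_cutCap_union_le c S T
  have hunion := hT.2 _ (isCut_union hS.1 hT.1)
  exact le_of_add_le_add_right (hsub.trans (add_le_add_right hunion _))

/-- If the satisfying family of `B` (on cuts) is closed under pairwise intersection and
there exists a min-cut satisfying `B` and containing `v`, then there is a least such
min-cut. -/
theorem exists_least_minCut {V : Type*} [Fintype V] (s t : V) (hst : s ≠ t)
    (c : V → V → NNReal) (B : Set V → Prop)
    (hInter : ∀ S T : Set V, IsCut s t S → IsCut s t T → B S → B T → B (S ∩ T))
    (v : V) (S : Set V) (hS : IsMinCut s t c S) (hBS : B S) (hv : v ∈ S) :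
    ∃ S₀ : Set V, IsMinCut s t c S₀ ∧ B S₀ ∧ v ∈ S₀ ∧
      ∀ S' : Set V, IsMinCut s t c S' → B S' → v ∈ S' → S₀ ⊆ S' := by
  obtain ⟨S₀, ⟨hmin, hB, hmem⟩, hleast⟩ :=
    (Set.toFinite {S : Set V | IsMinCut s t c S ∧ B S ∧ v ∈ S}).exists_minimal ⟨S, hS, hBS, hv⟩
  refine ⟨S₀, hmin, hB, hmem, fun S' hmin' hB' hmem' => ?_⟩
  have hinter : S₀ ⊆ S₀ ∩ S' :=
    hleast ⟨isMinCut_inter hmin hmin', hInter S₀ S' hmin.1 hmin'.1 hB hB', hmem, hmem'⟩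
      Set.inter_subset_left
  exact hinter.trans Set.inter_subset_right
end
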